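/- arXiv:2306.16951 — 2 statements merged into one kernel-verified Lean document; each statement's English description precedes it below -/
import Mathlib

section
/- Let F be the free group on generators x₁, …, xₙ with n ≥ 2, let R_i be the normal closure of x_i in F for 1 ≤ i ≤ n, and let R₀ be the normal closure of x₁x₂⋯xₙ in F. Then R₀ ∩ R₁ ∩ ⋯ ∩ Rₙ = R₀ ∩ [R₁, …, Rₙ]_S. -/
/-- The left-normed iterated commutator subgroup
`[N₁, …, N_k] = [[…[[N₁, N₂], N₃]…], N_k]` of a list of subgroups. -/
def iterComm {G : Type*} [Group G] : List (Subgroup G) → Subgroup G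
  | [] => ⊥
  | N :: l => l.foldl (fun A B => ⁅A, B⁆) N

/-- The symmetric commutator subgroup `[N₁, …, N_k]_S`: the subgroup generated by all
left-normed iterated commutator subgroups `[N_{σ(1)}, …, N_{σ(k)}]` over permutations `σ`. -/
def symmComm {G : Type*} [Group G] {k : ℕ} (N : Fin k → Subgroup G) : Subgroup G :=
  ⨆ σ : Equiv.Perm (Fin k), iterComm (List.ofFn fun i => N (σ i))

/-- In the free group on `n` generators `x₁, …, xₙ` (indexed by `Fin n`), `R n 0` is the
normal closure of the product `x₁x₂⋯xₙ`, and `R n i` for `i ≠ 0` is the normal closure of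
the generator `x_i`. -/
def R (n : ℕ) (i : Fin (n + 1)) : Subgroup (FreeGroup (Fin n)) :=
  if h : i = 0 then
    Subgroup.normalClosure {(List.ofFn fun j : Fin n => FreeGroup.of j).prod}
  else
    Subgroup.normalClosure {FreeGroup.of (i.pred h)}

open Subgroup
open scoped commutatorElement

section General

variable {G Q ι : Type*} [Group G] [Group Q]

theorem Subgroup.commutator_iSup_le {κ : Sort*} {A : κ → Subgroup G} {B K : Subgroup G}
    [K.Normal] (h : ∀ i, ⁅A i, B⁆ ≤ K) : ⁅iSup A, B⁆ ≤ K := by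
  have key (H : Subgroup G) : ⁅H, B⁆ ≤ K ↔
      H ≤ (centralizer (B.map (QuotientGroup.mk' K) : Set (G ⧸ K))).comap
        (QuotientGroup.mk' K) := by
    rw [← map_le_iff_le_comap, ← commutator_eq_bot_iff_le_centralizer, ← map_commutator,
      map_eq_bot_iff, QuotientGroup.ker_mk']
  rw [key]
  exact iSup_le fun i => (key _).1 (h i)

/-- The **three subgroups lemma** relative to a normal subgroup. -/
theorem Subgroup.commutator_commutator_le_of_rotate {A B C K : Subgroup G} [K.Normal]
    (h₁ : ⁅⁅B, C⁆, A⁆ ≤ K) (h₂ : ⁅⁅C, A⁆, B⁆ ≤ K) : ⁅⁅A, B⁆, C⁆ ≤ K := by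
  have key (H : Subgroup G) : H ≤ K ↔ H.map (QuotientGroup.mk' K) = ⊥ := by
    rw [map_eq_bot_iff, QuotientGroup.ker_mk']
  simp only [key, map_commutator] at h₁ h₂ ⊢
  exact commutator_commutator_eq_bot_of_rotate h₁ h₂

theorem iterComm_concat {l : List (Subgroup G)} (hl : l ≠ []) (N : Subgroup G) :
    iterComm (l ++ [N]) = ⁅iterComm l, N⁆ := by
  cases l with
  | nil => exact absurd rfl hl
  | cons M l => simp [iterComm]

theorem iterComm_normal {l : List (Subgroup G)} (hl : ∀ N ∈ l, N.Normal) :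
    (iterComm l).Normal := by
  induction l using List.reverseRecOn with
  | nil => exact inferInstanceAs (⊥ : Subgroup G).Normal
  | append_singleton l N ih =>
    have hN : N.Normal := hl N (by simp)
    have := ih fun M hM => hl M (by simp [hM])
    rcases eq_or_ne l [] with rfl | h
    · exact hN
    · rw [iterComm_concat h]
      infer_instance

theorem iterComm_le {l : List (Subgroup G)} (hl : ∀ N ∈ l, N.Normal) {N : Subgroup G}
    (hN : N ∈ l) : iterComm l ≤ N := by
  induction l using List.reverseRecOn with
  | nil => simp at hN
  | append_singleton l M ih =>
    have hM : M.Normal := hl M (by simp)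
    have hl' : ∀ N ∈ l, N.Normal := fun N hN => hl N (by simp [hN])
    have := iterComm_normal hl'
    rcases eq_or_ne l [] with rfl | h
    · obtain rfl : N = M := by simpa using hN
      exact le_rfl
    · rw [iterComm_concat h]
      rcases List.mem_append.1 hN with hN | hN
      · exact (commutator_le_left _ _).trans (ih hl' hN)
      · obtain rfl : N = M := by simpa using hN
        exact commutator_le_right _ _

/-- The symmetric commutator subgroup of the family `N` along a list of indices. -/
def listSymmComm (N : ι → Subgroup G) (l : List ι) : Subgroup G :=
  ⨆ l' : {l' : List ι // l'.Perm l}, iterComm (l'.1.map N)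

theorem iterComm_le_listSymmComm (N : ι → Subgroup G) {l l' : List ι} (h : l'.Perm l) :
    iterComm (l'.map N) ≤ listSymmComm N l :=
  le_iSup (fun l' : {l' : List ι // l'.Perm l} => iterComm (l'.1.map N)) ⟨l', h⟩

theorem listSymmComm_congr (N : ι → Subgroup G) {l l' : List ι} (h : l.Perm l') :
    listSymmComm N l = listSymmComm N l' :=
  le_antisymm (iSup_le fun m => iterComm_le_listSymmComm N (m.2.trans h))
    (iSup_le fun m => iterComm_le_listSymmComm N (m.2.trans h.symm))

variable (N : ι → Subgroup G) [hN : ∀ i, (N i).Normal]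

instance iterComm_map_normal (l : List ι) : (iterComm (l.map N)).Normal :=
  iterComm_normal fun M hM => by
    obtain ⟨i, -, rfl⟩ := List.mem_map.1 hM
    exact hN i

instance listSymmComm_normal (l : List ι) : (listSymmComm N l).Normal := by
  unfold listSymmComm
  infer_instance

theorem commutator_listSymmComm_le (l : List ι) (j : ι) :
    ⁅listSymmComm N l, N j⁆ ≤ listSymmComm N (l ++ [j]) := by
  refine commutator_iSup_le fun m => ?_
  obtain ⟨m, hm⟩ := m
  rcases eq_or_ne m [] with rfl | h
  · simp [iterComm]
  · rw [← iterComm_concat (by simpa using h)]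
    simpa using iterComm_le_listSymmComm N (hm.append_right [j])

theorem map_commutatorElement_eq_of_commute (f : G →* Q) {A B : Subgroup G} [A.Normal]
    [B.Normal] {a a' b b' : G} (ha' : a' ∈ A) (hb : b ∈ B)
    (hs : ∀ m ∈ B, Commute (f (a * a'⁻¹)) (f m)) (ht : ∀ p ∈ A, Commute (f (b * b'⁻¹)) (f p)) :
    f ⁅a, b⁆ = f ⁅a', b'⁆ := by
  have h₁ := (hs (a' * b * a'⁻¹) (Normal.conj_mem inferInstance _ hb _)).eq
  have h₂ := (ht (b' * a'⁻¹ * b'⁻¹)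
    (Normal.conj_mem inferInstance _ (inv_mem ha') _)).eq
  calc f ⁅a, b⁆ = f (a * a'⁻¹) * f (a' * b * a'⁻¹) * (f (a * a'⁻¹))⁻¹ * f b⁻¹ := by
        rw [commutatorElement_def]
        simp only [← map_mul, ← map_inv]
        congr 1
        group
    _ = f a' * (f (b * b'⁻¹) * f (b' * a'⁻¹ * b'⁻¹) * (f (b * b'⁻¹))⁻¹) := by
        rw [h₁, mul_inv_cancel_right]
        simp only [← map_mul, ← map_inv]
        congr 1
        group
    _ = f ⁅a', b'⁆ := by
        rw [h₂, mul_inv_cancel_right, commutatorElement_def]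
        simp only [← map_mul]
        congr 1
        group

theorem mk_eq_mk_iff_mul_inv_mem {K : Subgroup G} [K.Normal] {a b : G} :
    QuotientGroup.mk' K a = QuotientGroup.mk' K b ↔ a * b⁻¹ ∈ K := by
  rw [← mul_inv_eq_one, ← map_inv, ← map_mul, ← MonoidHom.mem_ker, QuotientGroup.ker_mk']

theorem commute_mk_of_commutator_le {A B K : Subgroup G} [K.Normal] (h : ⁅A, B⁆ ≤ K) {a b : G}
    (ha : a ∈ A) (hb : b ∈ B) :
    Commute (QuotientGroup.mk' K a) (QuotientGroup.mk' K b) := by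
  rw [← commutatorElement_eq_one_iff_commute, ← map_commutatorElement, ← MonoidHom.mem_ker,
    QuotientGroup.ker_mk']
  exact h (commutator_mem_commutator ha hb)

theorem iterComm_mul_inv_map_mem (d : G →* G) (k : ι) {l : List ι} (hl : l ≠ [])
    (hd : ∀ i ∈ l, ∀ r ∈ N i, d r ∈ N i ∧ r * (d r)⁻¹ ∈ ⁅N i, N k⁆) :
    ∀ a ∈ iterComm (l.map N),
      d a ∈ iterComm (l.map N) ∧ a * (d a)⁻¹ ∈ listSymmComm N (l ++ [k]) := by
  induction l using List.reverseRecOn with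
  | nil => exact absurd rfl hl
  | append_singleton l j ih =>
    have hj := hd j (by simp)
    rcases eq_or_ne l [] with rfl | h
    · intro a ha
      refine ⟨(hj a ha).1, ?_⟩
      exact iterComm_le_listSymmComm N (List.Perm.refl [j, k]) (hj a ha).2
    · replace ih := ih h fun i hi => hd i (by simp [hi])
      rw [List.map_append, List.map_singleton, iterComm_concat (by simpa using h)]
      set C := iterComm (l.map N) with hC
      set T := listSymmComm N (l ++ [j] ++ [k]) with hT
      have hperm : (l ++ [k] ++ [j]).Perm (l ++ [j] ++ [k]) := by
        simpa using (List.Perm.swap j k []).append_left l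
      have h₁ : ⁅listSymmComm N (l ++ [k]), N j⁆ ≤ T :=
        (commutator_listSymmComm_le N _ j).trans (listSymmComm_congr N hperm).le
      have hCk : ⁅N k, C⁆ ≤ listSymmComm N (l ++ [k]) := by
        rw [commutator_comm, hC, ← iterComm_concat (by simpa using h)]
        simpa using iterComm_le_listSymmComm N (List.Perm.refl (l ++ [k]))
      have h₂ : ⁅⁅C, N j⁆, N k⁆ ≤ T := by
        rw [hC, ← iterComm_concat (by simpa using h), ← iterComm_concat (by simp)]
        simpa [hT] using iterComm_le_listSymmComm N (List.Perm.refl (l ++ [j] ++ [k]))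
      have h₃ : ⁅⁅N j, N k⁆, C⁆ ≤ T :=
        commutator_commutator_le_of_rotate ((commutator_mono hCk le_rfl).trans h₁) h₂
      have e₁ : ⁅C, N j⁆ ≤ ⁅C, N j⁆.comap d := by
        refine commutator_le.2 fun a ha b hb => ?_
        rw [mem_comap, map_commutatorElement]
        exact commutator_mem_commutator (ih a ha).1 (hj b hb).1
      have e₂ : ⁅C, N j⁆ ≤
          (QuotientGroup.mk' T).eqLocus ((QuotientGroup.mk' T).comp d) := by
        refine commutator_le.2 fun a ha b hb => ?_
        change QuotientGroup.mk' T _ = QuotientGroup.mk' T (d _)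
        rw [map_commutatorElement d]
        exact map_commutatorElement_eq_of_commute _ (ih a ha).1 hb
          (fun m hm => commute_mk_of_commutator_le h₁ (ih a ha).2 hm)
          (fun p hp => commute_mk_of_commutator_le h₃ (hj b hb).2 hp)
      exact fun a ha => ⟨e₁ ha, mk_eq_mk_iff_mul_inv_mem.1 (e₂ ha)⟩

theorem listSymmComm_mul_inv_map_mem (d : G →* G) (k : ι) {l : List ι} (hl : l ≠ [])
    (hd : ∀ i ∈ l, ∀ r ∈ N i, d r ∈ N i ∧ r * (d r)⁻¹ ∈ ⁅N i, N k⁆) :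
    ∀ a ∈ listSymmComm N l, a * (d a)⁻¹ ∈ listSymmComm N (l ++ [k]) := by
  set T := listSymmComm N (l ++ [k]) with hT
  have e : listSymmComm N l ≤
      (QuotientGroup.mk' T).eqLocus ((QuotientGroup.mk' T).comp d) := by
    refine iSup_le fun m a ha => ?_
    have := (iterComm_mul_inv_map_mem N d k (l := m.1)
      (fun h => hl (by simpa [h] using m.2.symm)) (fun i hi => hd i (m.2.subset hi)) a ha).2
    rw [listSymmComm_congr N (m.2.append_right [k])] at this
    exact mk_eq_mk_iff_mul_inv_mem.2 this
  exact fun a ha => mk_eq_mk_iff_mul_inv_mem.1 (e ha)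

end General

section Free

variable {α : Type*}

/-- The normal closure of a generator of a free group. -/
def generatorClosure (i : α) : Subgroup (FreeGroup α) := normalClosure {FreeGroup.of i}

instance generatorClosure_normal (i : α) : (generatorClosure i).Normal :=
  normalClosure_normal

open Classical in
/-- The endomorphism of a free group deleting the generator `k`. -/
noncomputable def deleteGenerator (k : α) : FreeGroup α →* FreeGroup α :=
  FreeGroup.lift fun i => if i = k then 1 else FreeGroup.of i

theorem deleteGenerator_of_self (k : α) : deleteGenerator k (FreeGroup.of k) = 1 := by
  simp [deleteGenerator]

theorem deleteGenerator_of_ne {i k : α} (h : i ≠ k) :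
    deleteGenerator k (FreeGroup.of i) = FreeGroup.of i := by
  simp [deleteGenerator, h]

theorem deleteGenerator_eq_one {k : α} {w : FreeGroup α} (hw : w ∈ generatorClosure k) :
    deleteGenerator k w = 1 := by
  have : generatorClosure k ≤ (deleteGenerator k).ker :=
    normalClosure_le_normal (by simp [MonoidHom.mem_ker, deleteGenerator_of_self])
  exact this hw

theorem mul_inv_deleteGenerator_mem (k : α) (w : FreeGroup α) :
    w * (deleteGenerator k w)⁻¹ ∈ generatorClosure k := by
  have : QuotientGroup.mk' (generatorClosure k) =
      (QuotientGroup.mk' (generatorClosure k)).comp (deleteGenerator k) := by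
    refine FreeGroup.ext_hom _ _ fun i => ?_
    refine mk_eq_mk_iff_mul_inv_mem.2 ?_
    rcases eq_or_ne i k with rfl | h
    · rw [deleteGenerator_of_self, inv_one, mul_one]
      exact subset_normalClosure rfl
    · rw [deleteGenerator_of_ne h, mul_inv_cancel]
      exact one_mem _
  exact mk_eq_mk_iff_mul_inv_mem.1 (DFunLike.congr_fun this w)

theorem deleteGenerator_mem_and_mul_inv_mem {i k : α} (h : i ≠ k) {r : FreeGroup α}
    (hr : r ∈ generatorClosure i) :
    deleteGenerator k r ∈ generatorClosure i ∧
      r * (deleteGenerator k r)⁻¹ ∈ ⁅generatorClosure i, generatorClosure k⁆ := by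
  have hof : FreeGroup.of i ∈ generatorClosure i := subset_normalClosure rfl
  constructor
  · have : generatorClosure i ≤ (generatorClosure i).comap (deleteGenerator k) := by
      refine normalClosure_le_normal ?_
      rintro _ rfl
      change deleteGenerator k (FreeGroup.of i) ∈ generatorClosure i
      rwa [deleteGenerator_of_ne h]
    exact this hr
  · set K := ⁅generatorClosure i, generatorClosure k⁆ with hK
    have : generatorClosure i ≤
        (QuotientGroup.mk' K).eqLocus ((QuotientGroup.mk' K).comp (deleteGenerator k)) := by
      refine (closure_le _).2 fun x hx => ?_
      obtain ⟨y, rfl, hy⟩ := Group.mem_conjugatesOfSet_iff.1 hx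
      obtain ⟨g, rfl⟩ := isConj_iff.1 hy
      change QuotientGroup.mk' K _ = QuotientGroup.mk' K (deleteGenerator k _)
      have hc := (commute_mk_of_commutator_le (commutator_comm _ _ |>.trans hK.symm).le
        (mul_inv_deleteGenerator_mem k g)
        (generatorClosure_normal i |>.conj_mem _ hof (deleteGenerator k g))).eq
      simp only [map_mul, map_inv, deleteGenerator_of_ne h] at hc ⊢
      rw [← mul_inv_eq_iff_eq_mul] at hc
      rw [← hc]
      group
    exact mk_eq_mk_iff_mul_inv_mem.1 (this hr)

theorem mem_listSymmComm_of_forall_mem {l : List α} (hl : l ≠ []) (hnd : l.Nodup)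
    {w : FreeGroup α} (hw : ∀ i ∈ l, w ∈ generatorClosure i) :
    w ∈ listSymmComm generatorClosure l := by
  induction l using List.reverseRecOn with
  | nil => exact absurd rfl hl
  | append_singleton l k ih =>
    rcases eq_or_ne l [] with rfl | h
    · exact iterComm_le_listSymmComm _ (List.Perm.refl [k]) (hw k (by simp))
    · have hnd' := List.nodup_append.1 hnd
      have := listSymmComm_mul_inv_map_mem generatorClosure (deleteGenerator k) k h
        (fun i hi r hr => deleteGenerator_mem_and_mul_inv_mem (hnd'.2.2 i hi k (by simp)) hr)
        w (ih h hnd'.1 fun i hi => hw i (by simp [hi]))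
      rwa [deleteGenerator_eq_one (hw k (by simp)), inv_one, mul_one] at this

end Free

theorem listSymmComm_finRange_le_symmComm {G : Type*} [Group G] {n : ℕ}
    (N : Fin n → Subgroup G) : listSymmComm N (List.finRange n) ≤ symmComm N := by
  refine iSup_le fun m => ?_
  obtain ⟨m, hm⟩ := m
  have hlen : m.length = n := by simpa using hm.length_eq
  have hnd : m.Nodup := hm.nodup_iff.2 (List.nodup_finRange n)
  let σ : Equiv.Perm (Fin n) := (finCongr hlen.symm).trans
    (hnd.getEquivOfForallMemList m fun i => hm.mem_iff.2 (List.mem_finRange i))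
  have hσ : m.map N = List.ofFn fun i => N (σ i) := by
    refine List.ext_getElem (by simp [hlen]) fun i h₁ h₂ => ?_
    simp [σ]
  change iterComm (m.map N) ≤ _
  rw [hσ]
  exact le_iSup (fun σ : Equiv.Perm (Fin n) => iterComm (List.ofFn fun i => N (σ i))) σ

theorem symmComm_le {G : Type*} [Group G] {n : ℕ} (N : Fin n → Subgroup G)
    [hN : ∀ i, (N i).Normal] (j : Fin n) : symmComm N ≤ N j := by
  refine iSup_le fun σ => iterComm_le ?_ ?_
  · intro M hM
    obtain ⟨i, rfl⟩ := List.mem_ofFn.1 hM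
    exact hN _
  · exact List.mem_ofFn.2 ⟨σ.symm j, by simp⟩

/-- For `n ≥ 2`, in the free group on `x₁, …, xₙ`, with `R_i` the normal closure of `x_i`
and `R₀` the normal closure of `x₁⋯xₙ`, one has
`R₀ ∩ R₁ ∩ ⋯ ∩ Rₙ = R₀ ∩ [R₁, …, Rₙ]_S`. -/
theorem iInf_eq_inf_symmComm (n : ℕ) (hn : 2 ≤ n) :
    (⨅ i : Fin (n + 1), R n i) = R n 0 ⊓ symmComm (fun j : Fin n => R n j.succ) := by
  have hR : (fun j : Fin n => R n j.succ) = generatorClosure := by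
    funext j
    simp [R, generatorClosure]
  rw [hR]
  refine le_antisymm (le_inf (iInf_le _ 0) fun w hw => ?_) (le_iInf fun i => ?_)
  · refine listSymmComm_finRange_le_symmComm _ (mem_listSymmComm_of_forall_mem
      (List.ne_nil_of_length_pos (by simp; omega)) (List.nodup_finRange n) fun i _ => ?_)
    rw [← hR]
    exact mem_iInf.1 hw i.succ
  · cases i using Fin.cases with
    | zero => exact inf_le_left
    | succ j => exact inf_le_right.trans ((symmComm_le _ j).trans (congrFun hR j).ge)
end

section
/- Let F be the free group on four generators x₁, x₂, x₃, x₄, let R_i be the normal closure of x_i for i = 1, 2, 3, 4, and let R₀ be the normal closure of x₁x₂x₃x₄. Then the element w = [[[x₁, x₂], [x₁, x₂x₃]], [[x₁, x₂], [x₁, x₂x₃x₄]]] does NOT belong to the symmetric commutator subgroup [R₀, R₁, R₂, R₃, R₄]_S. -/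
/-- The commutator `[u, v] = u⁻¹v⁻¹uv` of two group elements. -/
def commE {G : Type*} [Group G] (u v : G) : G := u⁻¹ * v⁻¹ * u * v

namespace SymmComm

section Groups

variable {G H : Type*} [Group G] [Group H]

theorem foldl_commutator_le (l : List (Subgroup G)) (A : Subgroup G) (hA : A.Normal)
    (hl : ∀ B ∈ l, B.Normal) :
    l.foldl (fun A B => ⁅A, B⁆) A ≤ A ∧ ∀ B ∈ l, l.foldl (fun A B => ⁅A, B⁆) A ≤ B := by
  induction l generalizing A with
  | nil => simp
  | cons C l ih =>
    have hC : C.Normal := hl C (by simp)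
    obtain ⟨h₁, h₂⟩ := ih ⁅A, C⁆ inferInstance fun B hB => hl B (by simp [hB])
    refine ⟨h₁.trans (Subgroup.commutator_le_left A C), fun B hB => ?_⟩
    rcases List.mem_cons.1 hB with rfl | hB
    · exact h₁.trans (Subgroup.commutator_le_right A B)
    · exact h₂ B hB

theorem iterComm_le {l : List (Subgroup G)} (hl : ∀ B ∈ l, B.Normal) {A : Subgroup G}
    (hA : A ∈ l) : iterComm l ≤ A := by
  cases l with
  | nil => simp at hA
  | cons C l =>
    obtain ⟨h₁, h₂⟩ := foldl_commutator_le l C (hl C (by simp)) fun B hB => hl B (by simp [hB])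
    rcases List.mem_cons.1 hA with rfl | hA
    · exact h₁
    · exact h₂ A hA

theorem map_iterComm (f : G →* H) (l : List (Subgroup G)) :
    (iterComm l).map f = iterComm (l.map (Subgroup.map f)) := by
  cases l with
  | nil => simp [iterComm]
  | cons A l =>
    simp only [iterComm, List.map_cons]
    induction l generalizing A with
    | nil => rfl
    | cons B l ih => simp [ih, Subgroup.map_commutator]

theorem symmComm_le {k : ℕ} {N : Fin k → Subgroup G} (hN : ∀ i, (N i).Normal) (i : Fin k) :
    symmComm N ≤ N i := by
  refine iSup_le fun σ => iterComm_le ?_ ?_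
  · intro B hB
    obtain ⟨j, rfl⟩ := (List.mem_ofFn' _ _).1 hB
    exact hN _
  · exact (List.mem_ofFn' _ _).2 ⟨σ.symm i, by simp⟩

theorem map_symmComm {k : ℕ} (f : G →* H) (N : Fin k → Subgroup G) :
    (symmComm N).map f = symmComm fun i => (N i).map f := by
  simp only [symmComm, Subgroup.map_iSup, map_iterComm, List.map_ofFn]
  rfl

theorem normalClosure_singleton_inv (g : G) :
    Subgroup.normalClosure {g⁻¹} = Subgroup.normalClosure {g} := by
  apply le_antisymm <;> refine Subgroup.normalClosure_le_normal (Set.singleton_subset_iff.2 ?_)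
  · exact inv_mem (Subgroup.subset_normalClosure rfl)
  · exact inv_mem_iff.1 (Subgroup.subset_normalClosure rfl)

end Groups

section Cover

/-- The product `x₁x₂⋯xₙ` of the generators. -/
def genProd (n : ℕ) : FreeGroup (Fin n) := (List.ofFn fun j : Fin n => FreeGroup.of j).prod

/-- The epimorphism from the free group on `n + 1` generators sending the first generator to
`(x₁x₂⋯xₙ)⁻¹` and the other ones to `x₁, …, xₙ`. -/
def cover (n : ℕ) : FreeGroup (Fin (n + 1)) →* FreeGroup (Fin n) :=
  FreeGroup.lift (Fin.cons (genProd n)⁻¹ FreeGroup.of)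

theorem cover_surjective (n : ℕ) : Function.Surjective (cover n) := by
  intro g
  refine ⟨FreeGroup.map Fin.succ g, ?_⟩
  have : (cover n).comp (FreeGroup.map Fin.succ) = MonoidHom.id _ := by
    ext i
    simp [cover]
  exact DFunLike.congr_fun this g

theorem map_cover_normalClosure (n : ℕ) (i : Fin (n + 1)) :
    (Subgroup.normalClosure {FreeGroup.of i}).map (cover n) = R n i := by
  rw [Subgroup.map_normalClosure _ _ (cover_surjective n), Set.image_singleton]
  refine Fin.cases ?_ (fun j => ?_) i
  · simpa [cover, R, genProd] using normalClosure_singleton_inv (genProd n)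
  · simp [cover, R]

/-- An element of `[R₀, …, Rₙ]_S` lifts to an element lying in the normal closure of each of
the `n + 1` generators. -/
theorem exists_lift_of_mem_symmComm {n : ℕ} {b : FreeGroup (Fin n)} (hb : b ∈ symmComm (R n)) :
    ∃ c, cover n c = b ∧ ∀ i, c ∈ Subgroup.normalClosure {FreeGroup.of i} := by
  have h : R n = fun i => (Subgroup.normalClosure {FreeGroup.of i}).map (cover n) :=
    funext fun i => (map_cover_normalClosure n i).symm
  rw [h, ← map_symmComm] at hb
  obtain ⟨c, hc, rfl⟩ := hb
  exact ⟨c, rfl, fun i => symmComm_le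
    (N := fun i => Subgroup.normalClosure {FreeGroup.of i})
    (fun _ => Subgroup.normalClosure_normal) i hc⟩

end Cover

section Polynomials

/-- Polynomials over `𝔽₂` as lists of square-free monomials, a monomial being the list of its
variables. -/
abbrev PolyF₂ := List (List ℕ)

/-- The value of a polynomial over `𝔽₂`. -/
def PolyF₂.eval (x : ℕ → Bool) (p : PolyF₂) : Bool :=
  p.foldr (fun m b => (m.all x) ^^ b) false

theorem PolyF₂.eval_congr {x y : ℕ → Bool} {p : PolyF₂}
    (h : ∀ m ∈ p, ∀ i ∈ m, x i = y i) : p.eval x = p.eval y := by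
  induction p with
  | nil => rfl
  | cons m p ih =>
    have hm : m.all x = m.all y := by
      rw [Bool.eq_iff_iff, List.all_eq_true, List.all_eq_true]
      exact forall₂_congr fun i hi => by rw [h m (by simp) i hi]
    have hp := ih fun m' hm' => h m' (by simp [hm'])
    simp only [eval, List.foldr_cons] at hp ⊢
    rw [hm, hp]

theorem PolyF₂.eval_eq_false {x : ℕ → Bool} {p : PolyF₂}
    (h : ∀ m ∈ p, ∃ i ∈ m, x i = false) : p.eval x = false := by
  induction p with
  | nil => rfl
  | cons m p ih =>
    have hm : m.all x = false := List.all_eq_false.2 (by simpa using h m (by simp))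
    have hp := ih fun m' hm' => h m' (by simp [hm'])
    simp only [eval, List.foldr_cons] at hp ⊢
    rw [hm, hp]
    rfl

/-- Boolean functions in Horner form: `node p q` stands for `p + X₀ q`, with the variables
of `p` and `q` shifted by one. -/
inductive Horner
  | zero
  | one
  | node (p q : Horner)

namespace Horner

/-- The Boolean function described by a Horner form. -/
def eval : Horner → (ℕ → Bool) → Bool
  | zero, _ => false
  | one, _ => true
  | node p q, x => p.eval (fun i => x (i + 1)) ^^ (x 0 && q.eval (fun i => x (i + 1)))

/-- `p + X₀ q`, normalized so that zero is always represented by `zero`. -/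
def mk : Horner → Horner → Horner
  | zero, zero => zero
  | p, q => node p q

/-- Addition of `1`. -/
def addOne : Horner → Horner
  | zero => one
  | one => zero
  | node p q => mk p.addOne q

/-- Addition. -/
def add : Horner → Horner → Horner
  | zero, q => q
  | one, q => q.addOne
  | node p q, zero => node p q
  | node p q, one => mk p.addOne q
  | node p q, node p' q' => mk (p.add p') (q.add q')

/-- Multiplication. -/
def mul : Horner → Horner → Horner
  | zero, _ => zero
  | one, q => q
  | node _ _, zero => zero
  | node p q, one => node p q
  | node p q, node p' q' => mk (p.mul p') ((p.mul q').add (q.mul (p'.add q')))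

/-- The variables. -/
def var : ℕ → Horner
  | 0 => node zero one
  | i + 1 => node (var i) zero

/-- Whether a form is literally `zero`. -/
def isZero : Horner → Bool
  | zero => true
  | _ => false

/-- Substitution of Horner forms into a polynomial. -/
def subst (X : ℕ → Horner) (p : PolyF₂) : Horner :=
  p.foldr (fun m b => (m.foldr (fun i a => (X i).mul a) one).add b) zero

theorem eval_mk (p q : Horner) (x : ℕ → Bool) : (mk p q).eval x = (node p q).eval x := by
  cases p <;> cases q <;> simp [mk, eval]

theorem eval_addOne (p : Horner) (x : ℕ → Bool) : p.addOne.eval x = !p.eval x := by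
  induction p generalizing x with
  | zero => rfl
  | one => rfl
  | node p q ihp _ => simp [addOne, eval_mk, eval, ihp]

theorem eval_add (p q : Horner) (x : ℕ → Bool) : (p.add q).eval x = (p.eval x ^^ q.eval x) := by
  induction p generalizing q x with
  | zero => simp [add, eval]
  | one => simp [add, eval, eval_addOne]
  | node p₀ p₁ ih₀ ih₁ =>
    cases q with
    | zero => simp [add, eval]
    | one => simp [add, eval, eval_mk, eval_addOne]
    | node q₀ q₁ =>
      simp only [add, eval_mk, eval, ih₀, ih₁]
      generalize p₀.eval _ = a, p₁.eval _ = b, q₀.eval _ = c, q₁.eval _ = d, x 0 = e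
      revert a b c d e
      decide

theorem eval_mul (p q : Horner) (x : ℕ → Bool) : (p.mul q).eval x = (p.eval x && q.eval x) := by
  induction p generalizing q x with
  | zero => simp [mul, eval]
  | one => simp [mul, eval]
  | node p₀ p₁ ih₀ ih₁ =>
    cases q with
    | zero => simp [mul, eval]
    | one => simp [mul, eval]
    | node q₀ q₁ =>
      simp only [mul, eval_mk, eval, ih₀, ih₁, eval_add]
      generalize p₀.eval _ = a, p₁.eval _ = b, q₀.eval _ = c, q₁.eval _ = d, x 0 = e
      revert a b c d e
      decide

theorem eval_var (i : ℕ) (x : ℕ → Bool) : (var i).eval x = x i := by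
  induction i generalizing x with
  | zero => simp [var, eval]
  | succ i ih => simp [var, eval, ih]

theorem eval_subst (X : ℕ → Horner) (p : PolyF₂) (x : ℕ → Bool) :
    (subst X p).eval x = p.eval fun i => (X i).eval x := by
  induction p with
  | nil => rfl
  | cons m p ih =>
    have hm : (m.foldr (fun i a => (X i).mul a) one).eval x = m.all fun i => (X i).eval x := by
      induction m with
      | nil => rfl
      | cons i m ihm => simp [eval_mul, ihm]
    simp only [subst, PolyF₂.eval, List.foldr_cons, eval_add, hm] at ih ⊢
    rw [ih]

theorem eval_eq_of_isZero_add {p q : Horner} (h : (p.add q).isZero = true) (x : ℕ → Bool) :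
    p.eval x = q.eval x := by
  have h₀ : (p.add q).eval x = false := by
    cases hpq : p.add q <;> simp_all [isZero, eval]
  rw [eval_add] at h₀
  simpa using h₀

end Horner

end Polynomials

section Tables

/-- Increments of the maps `act k` on states with `22` coordinates: coordinate `j` changes by
the polynomial in row `k`, column `j`. -/
def actTable : List (List PolyF₂) :=
  [[],
   [[[]], [], [], [], [[0]], [], [], [], [], [], [], [], [], [], [], [], [], [], [], [], [], [[0,
    1, 8, 12], [0, 1, 9, 12], [0, 1, 10, 12], [0, 1, 11, 12], [4, 7, 12], [4, 9, 10], [4, 10, 12],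
    [4, 11, 12], [5, 8, 12], [5, 9, 12], [5, 10, 12], [5, 11, 12]]],
   [[], [[]], [], [], [], [[1]], [], [[0]], [], [], [], [], [], [[0, 7], [4]], [], [], [], [[0,
    8], [0, 10]], [[0, 8], [0, 9], [0, 10], [0, 11]], [[0, 9], [0, 11], [0, 12]], [], [[0, 1, 7,
    12], [0, 1, 9, 10], [0, 1, 10, 12], [0, 1, 11, 12], [0, 2, 7, 12], [0, 2, 8, 12], [0, 2, 9,
    10], [0, 2, 9, 12], [0, 3, 7, 8], [0, 3, 7, 10], [0, 3, 7, 12], [0, 3, 8, 10], [0, 3, 8, 12],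
    [0, 3, 9, 10], [0, 3, 9, 12], [0, 3, 14], [0, 7, 8, 12], [0, 7, 9, 12], [0, 7, 10, 12], [0, 7,
    11, 12], [0, 7, 12], [0, 8, 20], [0, 9, 17], [0, 9, 20], [0, 10, 20], [0, 11, 17], [0, 11,
    20], [0, 12, 17], [1, 2, 7, 12], [1, 2, 8, 12], [1, 2, 9, 10], [1, 2, 9, 11], [1, 2, 15], [1,
    3, 7, 10], [1, 3, 7, 12], [1, 3, 8, 10], [1, 3, 8, 12], [1, 3, 9, 10], [1, 3, 9, 12], [2, 3,
    7, 11], [2, 3, 7, 12], [2, 3, 8, 11], [2, 3, 8, 12], [2, 3, 9, 11], [2, 3, 9, 12], [3, 7, 8],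
    [3, 14], [4, 8, 12], [4, 9, 12], [4, 10, 11], [4, 10, 12], [4, 12], [5, 7, 12], [5, 8, 9], [5,
    8, 11], [5, 9, 12], [6, 7, 11], [6, 7, 12], [6, 8, 11], [6, 8, 12], [6, 15]]],
   [[], [], [[]], [], [], [], [[2]], [], [[0]], [], [[1]], [], [], [], [[0, 8], [4]], [], [], [[1,
    7], [1, 8]], [[1, 7], [1, 8], [1, 9]], [[0, 9], [0, 11], [0, 12]], [[0, 9], [0, 11], [0, 12],
    [1, 9], [1, 11], [1, 12]], [[0, 1, 11, 12], [0, 1, 16], [0, 2, 7, 9], [0, 2, 7, 11], [0, 2, 7,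
    12], [0, 2, 9, 10], [0, 2, 10, 11], [0, 2, 10, 12], [0, 2, 11, 12], [0, 2, 16], [0, 3, 7, 9],
    [0, 3, 7, 11], [0, 3, 7, 12], [0, 3, 9, 10], [0, 3, 10, 11], [0, 3, 10, 12], [0, 3, 11, 12],
    [0, 3, 16], [0, 7, 9, 12], [0, 7, 11, 12], [0, 7, 12], [0, 9, 17], [0, 11, 17], [0, 12, 17],
    [1, 2, 7, 12], [1, 2, 8, 9], [1, 2, 8, 11], [1, 2, 9, 12], [1, 3, 7, 10], [1, 3, 7, 12], [1,
    3, 8, 9], [1, 3, 8, 10], [1, 3, 8, 11], [1, 3, 9, 11], [1, 3, 15], [1, 7, 8, 12], [1, 7, 11,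
    12], [1, 7, 20], [1, 8, 20], [1, 9, 20], [1, 11, 17], [1, 11, 19], [1, 12, 17], [1, 12, 19],
    [2, 3, 7, 11], [2, 3, 7, 12], [2, 3, 8, 11], [2, 3, 9, 11], [2, 7, 9], [2, 7, 11], [3, 7, 9],
    [3, 7, 10], [3, 7, 11], [3, 8, 10], [4, 11, 12], [4, 16], [5, 7, 9], [5, 7, 11], [5, 7, 12],
    [5, 8, 9], [5, 8, 11], [5, 8, 12], [6, 7, 11], [6, 7, 12], [6, 8, 11], [6, 9, 11]]],
   [[], [], [], [[]], [], [], [], [], [], [[0]], [], [[1]], [[2]], [], [], [[0, 9], [4]], [[1,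
    11], [5]], [], [[1, 7], [1, 8], [1, 9]], [[1, 7], [1, 8], [1, 9], [2, 7], [2, 8], [2, 9]],
    [[2, 8], [2, 9], [2, 10], [2, 11]], [[1, 3, 7, 10], [1, 3, 7, 12], [1, 3, 8, 10], [1, 3, 8,
    12], [1, 3, 9, 10], [1, 3, 9, 12], [1, 7, 8, 12], [1, 7, 9, 12], [1, 7, 12], [1, 7, 17], [1,
    7, 20], [1, 8, 17], [1, 8, 20], [1, 9, 17], [1, 9, 20], [2, 3, 7, 11], [2, 3, 7, 12], [2, 3,
    8, 11], [2, 3, 9, 11], [2, 7, 8, 12], [2, 7, 9, 12], [2, 7, 10, 12], [2, 7, 11, 12], [2, 7,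
    12], [2, 7, 17], [2, 8, 17], [2, 9, 17], [2, 10, 17], [2, 10, 19], [2, 11, 17], [2, 11, 19],
    [2, 12, 13], [3, 7, 10], [3, 7, 12], [3, 8, 10], [3, 9, 10], [6, 7, 8], [6, 7, 9], [6, 8, 10],
    [6, 8, 11], [6, 9, 10], [6, 9, 11], [6, 13]]]]

/-- Increments of maps on states with `37` coordinates that lift the maps `act k`. -/
def liftActTable : List (List PolyF₂) :=
  [[],
   [[[]], [], [], [], [], [[0]], [], [], [], [], [], [], [], [], [], [], [], [], [], [], [], [],
    [], [], [], [], [], [], [], [], [], [], [], [], [], [], []],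
   [[], [[]], [], [], [], [], [[1]], [], [], [[0]], [], [], [], [], [], [], [], [], [], [[0, 9],
    [5]], [], [], [], [], [], [], [], [[0, 10], [0, 13]], [[0, 10], [0, 11], [0, 13], [0, 14]],
    [[0, 10], [0, 11], [0, 12], [0, 13], [0, 14], [0, 15]], [[0, 11], [0, 14], [0, 16]], [[0, 11],
    [0, 12], [0, 14], [0, 15], [0, 16], [0, 17]], [[0, 12], [0, 15], [0, 17], [0, 18]], [], [],
    [], []],
   [[], [], [[]], [], [], [], [], [[2]], [], [], [[0]], [], [], [[1]], [], [], [], [], [], [],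
    [[0, 10], [5]], [], [], [[1, 13], [6]], [], [], [], [[1, 9], [1, 10]], [[1, 9], [1, 10], [1,
    11]], [[1, 9], [1, 10], [1, 11], [1, 12]], [[0, 11], [0, 14], [0, 16]], [[0, 11], [0, 12], [0,
    14], [0, 15], [0, 16], [0, 17]], [[0, 12], [0, 15], [0, 17], [0, 18]], [[0, 11], [0, 14], [0,
    16], [1, 11], [1, 14], [1, 16]], [[0, 11], [0, 12], [0, 14], [0, 15], [0, 16], [0, 17], [1,
    11], [1, 12], [1, 14], [1, 15], [1, 16], [1, 17]], [[0, 12], [0, 15], [0, 17], [0, 18], [1,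
    12], [1, 15], [1, 17], [1, 18]], []],
   [[], [], [], [[]], [], [], [], [], [[3]], [], [], [[0]], [], [], [[1]], [], [[2]], [], [], [],
    [], [[0, 11], [5]], [], [], [[1, 14], [6]], [], [], [], [[1, 9], [1, 10], [1, 11]], [[1, 9],
    [1, 10], [1, 11], [1, 12]], [[1, 9], [1, 10], [1, 11], [2, 9], [2, 10], [2, 11]], [[1, 9], [1,
    10], [1, 11], [1, 12], [2, 9], [2, 10], [2, 11], [2, 12]], [[0, 12], [0, 15], [0, 17], [0,
    18]], [[2, 10], [2, 11], [2, 13], [2, 14]], [[2, 10], [2, 11], [2, 12], [2, 13], [2, 14], [2,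
    15]], [[0, 12], [0, 15], [0, 17], [0, 18], [1, 12], [1, 15], [1, 17], [1, 18]], [[0, 12], [0,
    15], [0, 17], [0, 18], [1, 12], [1, 15], [1, 17], [1, 18], [2, 12], [2, 15], [2, 17], [2,
    18]]],
   [[], [], [], [], [[]], [], [], [], [], [], [], [], [[0]], [], [], [[1]], [], [[2]], [[3]], [],
    [], [], [[0, 12], [5]], [], [], [[1, 15], [6]], [[2, 17], [7]], [], [], [[1, 9], [1, 10], [1,
    11], [1, 12]], [], [[1, 9], [1, 10], [1, 11], [1, 12], [2, 9], [2, 10], [2, 11], [2, 12]],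
    [[1, 9], [1, 10], [1, 11], [1, 12], [2, 9], [2, 10], [2, 11], [2, 12], [3, 9], [3, 10], [3,
    11], [3, 12]], [], [[2, 10], [2, 11], [2, 12], [2, 13], [2, 14], [2, 15]], [[2, 10], [2, 11],
    [2, 12], [2, 13], [2, 14], [2, 15], [3, 10], [3, 11], [3, 12], [3, 13], [3, 14], [3, 15]],
    [[3, 11], [3, 12], [3, 14], [3, 15], [3, 16], [3, 17]]]]

/-- The polynomial in row `i`, column `j` is the coordinate `j` of the `i`-th face of a state
with `37` coordinates. -/
def faceTable : List (List PolyF₂) :=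
  [[[[1]], [[2]], [[3]], [[4]], [[6]], [[7]], [[8]], [[13]], [[14]], [[15]], [[16]], [[17]],
    [[18]], [[23]], [[24]], [[25]], [[26]], [[9, 16], [27], [28], [30], [33]], [[9, 16], [9, 17],
    [27], [29], [31], [34]], [[9, 17], [9, 18], [28], [29], [32], [35]], [[9, 18], [10, 18], [30],
    [31], [32], [36]]],
   [[[0], [1]], [[2]], [[3]], [[4]], [[0, 1], [5], [6]], [[7]], [[8]], [[10], [13]], [[11], [14]],
    [[12], [15]], [[16]], [[17]], [[18]], [[10, 13], [20], [23]], [[11, 14], [21], [24]], [[12,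
    15], [22], [25]], [[26]], [[33]], [[34]], [[35]], [[36]]],
   [[[0]], [[1], [2]], [[3]], [[4]], [[5]], [[1, 2], [6], [7]], [[8]], [[9], [10]], [[11]],
    [[12]], [[14], [16]], [[15], [17]], [[18]], [[9, 10], [19], [20]], [[21]], [[22]], [[15, 17],
    [25], [26]], [[30]], [[31]], [[32]], [[36]]],
   [[[0]], [[1]], [[2], [3]], [[4]], [[5]], [[6]], [[2, 3], [7], [8]], [[9]], [[10], [11]],
    [[12]], [[13], [14]], [[15]], [[17], [18]], [[19]], [[10, 11], [20], [21]], [[22]], [[25]],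
    [[28]], [[29]], [[32]], [[35]]],
   [[[0]], [[1]], [[2]], [[3], [4]], [[5]], [[6]], [[7]], [[9]], [[10]], [[11], [12]], [[13]],
    [[14], [15]], [[16], [17]], [[19]], [[20]], [[11, 12], [21], [22]], [[14, 15], [24], [25]],
    [[27]], [[29]], [[31]], [[34]]],
   [[[0]], [[1]], [[2]], [[3]], [[5]], [[6]], [[7]], [[9]], [[10]], [[11]], [[13]], [[14]],
    [[16]], [[19]], [[20]], [[21]], [[24]], [[27]], [[28]], [[30]], [[33]]]]

/-- The polynomial measuring the total of the last coordinates of the six faces. -/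
def totalPoly : PolyF₂ :=
  [[9, 10, 16, 18], [9, 10, 17, 18], [9, 13, 16, 18], [9, 13, 17, 18], [9, 16, 32], [9, 16, 36],
   [9, 17, 33], [9, 17, 36], [9, 18, 27], [9, 18, 33], [10, 18, 27], [10, 18, 29], [13, 18, 27],
   [13, 18, 29], [13, 18, 30], [13, 18, 32], [16, 17, 19], [17, 18, 19], [27, 32], [27, 36], [28,
   32], [29, 33], [29, 34], [29, 35], [29, 36], [30, 32], [32, 33]]


/-- The entry in row `k`, column `j` of a table of polynomials. -/
def entry (t : List (List PolyF₂)) (k j : ℕ) : PolyF₂ := (t.getD k []).getD j []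

/-- The degeneracy-type reindexing `k ↦ k` for `k ≤ i` and `k ↦ k - 1` for `i < k`. -/
def collapse (i k : ℕ) : ℕ := if k ≤ i then k else k - 1

/-- The new coordinates under the map in row `k` of `liftActTable`, in Horner form. -/
def liftActHorner (k n : ℕ) : Horner :=
  (Horner.var n).add (Horner.subst Horner.var (entry liftActTable k n))

/-- The faces of a state with `37` coordinates, in Horner form. -/
def faceHorner (i j : ℕ) : Horner := Horner.subst Horner.var (entry faceTable i j)

theorem entry_actTable_lt : ∀ k < 5, ∀ j < 22, ∀ m ∈ entry actTable k j, ∀ i ∈ m, i < j := by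
  decide +kernel

theorem faceHorner_equivariant : ∀ k < 7, ∀ i < 6, ∀ j < 21,
    ((Horner.subst (liftActHorner k) (entry faceTable i j)).add
      ((faceHorner i j).add
        (Horner.subst (faceHorner i) (entry actTable (collapse i k) j)))).isZero = true := by
  decide +kernel

/-- The sum of the increments of the last coordinates of the six faces. -/
def totalIncr (k : ℕ) : Horner :=
  ((List.range 6).map fun i =>
    Horner.subst (faceHorner i) (entry actTable (collapse i k) 21)).foldr Horner.add Horner.zero

theorem totalPoly_equivariant : ∀ k < 7,
    ((Horner.subst (liftActHorner k) totalPoly).add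
      ((Horner.subst Horner.var totalPoly).add (totalIncr k))).isZero = true := by
  decide +kernel

/-- Each monomial of `totalPoly` has a variable that is a coordinate of a face other than the
zeroth one. -/
theorem exists_face_of_mem_totalPoly : ∀ m ∈ totalPoly, ∃ v ∈ m, ∃ i : Fin 5, ∃ j : Fin 21,
    entry faceTable (i + 1) j = [[v]] := by
  decide +kernel

end Tables

section Action

/-- States are vectors of `22` bits. -/
abbrev State := Fin 22 → Bool

/-- The coordinates of a state, extended by zero. -/
def coord (x : State) (n : ℕ) : Bool := if h : n < 22 then x ⟨n, h⟩ else false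

theorem coord_val (x : State) (j : Fin 22) : coord x j = x j := by simp [coord]

theorem coord_zero (n : ℕ) : coord 0 n = false := by
  unfold coord
  split_ifs <;> rfl

/-- The self-maps of the set of states given by `actTable`. -/
def actFun (k : ℕ) (x : State) : State := fun j => x j ^^ (entry actTable k j).eval (coord x)

theorem entry_actTable_of_le {k : ℕ} (hk : 5 ≤ k) (j : ℕ) : entry actTable k j = [] := by
  have : actTable.getD k [] = [] := List.getD_eq_default _ _ hk
  rw [entry, this, List.getD_nil]

theorem lt_of_mem_entry_actTable {k j : ℕ} (hj : j < 22) {m : List ℕ}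
    (hm : m ∈ entry actTable k j) {i : ℕ} (hi : i ∈ m) : i < j := by
  rcases lt_or_ge k 5 with hk | hk
  · exact entry_actTable_lt k hk j hj m hm i hi
  · simp [entry_actTable_of_le hk] at hm

theorem actFun_injective (k : ℕ) : Function.Injective (actFun k) := by
  intro x y h
  have key : ∀ n, coord x n = coord y n := by
    intro n
    induction n using Nat.strong_induction_on with
    | _ n ih =>
      by_cases hn : n < 22
      · have hc : (entry actTable k n).eval (coord x) = (entry actTable k n).eval (coord y) :=
          PolyF₂.eval_congr fun m hm i hi => ih i (lt_of_mem_entry_actTable hn hm hi)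
        have hx := congrFun h ⟨n, hn⟩
        simp only [actFun, hc] at hx
        simpa [coord, hn] using hx
      · simp [coord, hn]
  ext j
  rw [← coord_val x, ← coord_val y, key]

/-- The permutations of the set of states given by `actTable`. -/
noncomputable def act (k : ℕ) : Equiv.Perm State :=
  Equiv.ofBijective (actFun k) (Finite.injective_iff_bijective.1 (actFun_injective k))

theorem act_apply (k : ℕ) (x : State) : act k x = actFun k x := rfl

theorem act_of_le {k : ℕ} (hk : 5 ≤ k) : act k = 1 := by
  ext x j
  simp [act_apply, actFun, entry_actTable_of_le hk, PolyF₂.eval]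

theorem act_zero : act 0 = 1 := by
  ext x j
  have : entry actTable 0 j = [] := by simp [entry, actTable]
  simp [act_apply, actFun, this, PolyF₂.eval]

/-- The actions of the free group on five generators on the set of states: the `i`-th action
is induced by the action of `FreeGroup ℕ` through `collapse i`. -/
noncomputable def faceAct (i : ℕ) : FreeGroup (Fin 5) →* Equiv.Perm State :=
  FreeGroup.lift fun k => act (collapse i (k + 1)) * (act (collapse i (k + 2)))⁻¹

/-- The action of the free group on four generators on the set of states. -/
noncomputable def baseAct : FreeGroup (Fin 4) →* Equiv.Perm State :=
  FreeGroup.lift fun k => act (k + 1) * (act (k + 2))⁻¹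

theorem faceAct_zero : faceAct 0 = baseAct.comp (cover 4) := by
  ext1 k
  refine Fin.cases ?_ (fun j => ?_) k
  · simp [faceAct, baseAct, cover, genProd, collapse, act_zero, act_of_le, List.ofFn_succ,
      mul_assoc]
  · simp [faceAct, baseAct, cover, collapse]

theorem faceAct_eq_one_of_mem {c : FreeGroup (Fin 5)} {i : Fin 5}
    (hc : c ∈ Subgroup.normalClosure {FreeGroup.of i}) : faceAct (i + 1) c = 1 := by
  have : Subgroup.normalClosure {FreeGroup.of i} ≤ (faceAct (i + 1)).ker := by
    refine Subgroup.normalClosure_le_normal (Set.singleton_subset_iff.2 ?_)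
    simp [MonoidHom.mem_ker, faceAct, collapse]
  exact this hc

end Action

section Invariant

/-- A `6`-tuple of states is coherent if its members are the faces of one state with `37`
coordinates and the last coordinates sum up to the value of `totalPoly`. -/
def Coherent (T : Fin 6 → State) : Prop :=
  ∃ z : ℕ → Bool,
    (∀ i : Fin 6, ∀ j < 21, coord (T i) j = (entry faceTable i j).eval z) ∧
    (List.ofFn fun i => coord (T i) 21).foldr xor false = totalPoly.eval z

theorem coherent_zero : Coherent 0 := by
  refine ⟨fun _ => false, fun i j hj => ?_, ?_⟩
  · have h : ∀ i : Fin 6, ∀ j < 21, (entry faceTable i j).eval (fun _ => false) = false := by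
      decide +kernel
    rw [h i j hj]
    exact coord_zero j
  · have h : totalPoly.eval (fun _ => false) = false := by decide +kernel
    simp [h, coord_zero]

/-- The simultaneous action on the six members of a tuple. -/
noncomputable def tupleAct (k : ℕ) : Equiv.Perm (Fin 6 → State) :=
  Equiv.piCongrRight fun i => act (collapse i k)

theorem tupleAct_apply (k : ℕ) (T : Fin 6 → State) (i : Fin 6) :
    tupleAct k T i = act (collapse i k) (T i) := rfl

theorem tupleAct_inv_apply (k : ℕ) (T : Fin 6 → State) (i : Fin 6) :
    (tupleAct k)⁻¹ T i = (act (collapse i k))⁻¹ (T i) := rfl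

theorem eval_faceHorner (i n : ℕ) (z : ℕ → Bool) :
    (faceHorner i n).eval z = (entry faceTable i n).eval z := by
  simp [faceHorner, Horner.eval_subst, Horner.eval_var]

theorem foldr_xor_ofFn {n : ℕ} (f g : Fin n → Bool) :
    (List.ofFn fun i => f i ^^ g i).foldr xor false =
      ((List.ofFn f).foldr xor false ^^ (List.ofFn g).foldr xor false) := by
  induction n with
  | zero => simp
  | succ n ih =>
    simp only [List.ofFn_succ, List.foldr_cons, ih]
    generalize f 0 = a, g 0 = b, List.foldr _ _ _ = c, List.foldr _ _ _ = d
    revert a b c d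
    decide

theorem coord_act (k : ℕ) (x : State) {j : ℕ} (hj : j < 22) :
    coord (act k x) j = (coord x j ^^ (entry actTable k j).eval (coord x)) := by
  simp [coord, hj, act_apply, actFun]

theorem Coherent.tupleAct {T : Fin 6 → State} (hT : Coherent T) {k : ℕ} (hk : k < 7) :
    Coherent (tupleAct k T) := by
  obtain ⟨z, hz, hs⟩ := hT
  have hincr : ∀ i : Fin 6, ∀ j < 22, (entry actTable (collapse i k) j).eval (coord (T i)) =
      (Horner.subst (faceHorner i) (entry actTable (collapse i k) j)).eval z := by
    intro i j hj
    rw [Horner.eval_subst]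
    refine PolyF₂.eval_congr fun m hm n hn => ?_
    have := lt_of_mem_entry_actTable hj hm hn
    rw [hz i n (by omega), eval_faceHorner]
  refine ⟨fun n => (liftActHorner k n).eval z, fun i j hj => ?_, ?_⟩
  · have h := Horner.eval_eq_of_isZero_add (faceHorner_equivariant k hk i i.2 j hj) z
    rw [Horner.eval_subst, Horner.eval_add, eval_faceHorner, ← hincr i j (by omega),
      ← hz i j hj] at h
    rw [h]
    exact coord_act _ _ (by omega)
  · have h := Horner.eval_eq_of_isZero_add (totalPoly_equivariant k hk) z
    have ht : (totalIncr k).eval z = (List.ofFn fun i : Fin 6 =>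
        (entry actTable (collapse i k) 21).eval (coord (T i))).foldr xor false := by
      simp only [hincr _ 21 (by omega)]
      simp [totalIncr, List.range_succ, List.ofFn_succ, Horner.eval_add, Horner.eval]
    rw [Horner.eval_subst, Horner.eval_add, Horner.eval_subst, ht] at h
    simp only [Horner.eval_var] at h
    rw [h, ← hs]
    have hc : ∀ i : Fin 6, coord (SymmComm.tupleAct k T i) 21 =
        (coord (T i) 21 ^^ (entry actTable (collapse i k) 21).eval (coord (T i))) :=
      fun i => coord_act _ _ (by omega)
    simp only [hc]
    exact foldr_xor_ofFn _ _

theorem Coherent.tupleAct_inv {T : Fin 6 → State} (hT : Coherent T) {k : ℕ} (hk : k < 7) :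
    Coherent ((SymmComm.tupleAct k)⁻¹ T) := by
  obtain ⟨n, hn⟩ := mem_powers_iff_mem_zpowers.2
    (inv_mem (Subgroup.mem_zpowers (SymmComm.tupleAct k)))
  rw [← hn]
  clear hn
  induction n generalizing T with
  | zero => simpa using hT
  | succ n ih => simpa [pow_succ] using ih (hT.tupleAct hk)

theorem Coherent.faceAct {T : Fin 6 → State} (hT : Coherent T) (c : FreeGroup (Fin 5)) :
    Coherent fun i => faceAct i c (T i) := by
  induction c using FreeGroup.induction_on generalizing T with
  | C1 => simpa using hT
  | of k =>
    convert (hT.tupleAct_inv (k := k + 2) (by omega)).tupleAct (k := k + 1) (by omega) using 2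
    rw [SymmComm.tupleAct_apply, SymmComm.tupleAct_inv_apply]
    simp [SymmComm.faceAct]
  | inv_of k _ =>
    convert (hT.tupleAct_inv (k := k + 1) (by omega)).tupleAct (k := k + 2) (by omega) using 2
    rw [SymmComm.tupleAct_apply, SymmComm.tupleAct_inv_apply]
    simp [SymmComm.faceAct]
  | mul c d hc hd => simpa using hc (hd hT)

/-- If all members of a coherent tuple but the zeroth one vanish, then so does the last
coordinate of the zeroth one. -/
theorem Coherent.coord_eq_false {T : Fin 6 → State} (hT : Coherent T)
    (h : ∀ i : Fin 5, T i.succ = 0) : coord (T 0) 21 = false := by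
  obtain ⟨z, hz, hs⟩ := hT
  have hP : totalPoly.eval z = false := by
    refine PolyF₂.eval_eq_false fun m hm => ?_
    obtain ⟨v, hv, i, j, hij⟩ := exists_face_of_mem_totalPoly m hm
    refine ⟨v, hv, ?_⟩
    have := hz i.succ j j.2
    rw [h i, coord_zero, Fin.val_succ, hij] at this
    simpa [PolyF₂.eval] using this.symm
  rw [hP, List.ofFn_succ] at hs
  simpa [h, coord_zero, List.ofFn_succ] using hs

theorem coord_baseAct_of_mem {b : FreeGroup (Fin 4)} (hb : b ∈ symmComm (R 4)) :
    coord (baseAct b 0) 21 = false := by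
  obtain ⟨c, rfl, hc⟩ := exists_lift_of_mem_symmComm hb
  have := (coherent_zero.faceAct c).coord_eq_false fun i => by
    simp [faceAct_eq_one_of_mem (hc i)]
  simpa [faceAct_zero] using this

end Invariant

section Word

/-- The state whose coordinates are the binary digits of a number. -/
def ofBits (n : ℕ) : State := fun j => n.testBit j

/-- The action of `FreeGroup ℕ` on the set of states. -/
noncomputable def freeAct : FreeGroup ℕ →* Equiv.Perm State := FreeGroup.lift act

/-- Whether the generator `k` sends the state numbered `m` to the state numbered `n`. -/
def sends (k m n : ℕ) : Bool :=
  (List.range 22).all fun j =>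
    n.testBit j == (m.testBit j ^^ (entry actTable k j).eval m.testBit)

/-- Whether a list of numbers enumerates the states visited while a word acts, from the last
state to the first one. -/
def isPath : List (ℕ × Bool) → List ℕ → Bool
  | [], [_] => true
  | (k, e) :: w, n :: m :: l => (bif e then sends k m n else sends k n m) && isPath w (m :: l)
  | _, _ => false

theorem act_of_sends {k m n : ℕ} (h : sends k m n = true) : act k (ofBits m) = ofBits n := by
  ext j
  have hj := List.all_eq_true.1 h j (by simp)
  have hc : (entry actTable k j).eval (coord (ofBits m)) =
      (entry actTable k j).eval m.testBit := by
    refine PolyF₂.eval_congr fun _ hm i hi => ?_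
    have : i < 22 := (lt_of_mem_entry_actTable j.2 hm hi).trans j.2
    simp [coord, ofBits, this]
  rw [act_apply, actFun, hc]
  exact (beq_iff_eq.1 hj).symm

theorem freeAct_of_isPath {w : List (ℕ × Bool)} {l : List ℕ} (h : isPath w l = true)
    (hl : l ≠ []) :
    freeAct (FreeGroup.mk w) (ofBits (l.getLast hl)) = ofBits (l.head hl) := by
  fun_induction isPath w l with
  | case1 => simp [← FreeGroup.one_eq_mk]
  | case2 k e w n m l ih =>
    simp only [Bool.and_eq_true] at h
    have hw := ih h.2 (by simp)
    rw [List.getLast_cons (by simp), List.head_cons]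
    simp only [freeAct, FreeGroup.lift_mk, List.map_cons, List.prod_cons,
      Equiv.Perm.mul_apply] at hw ⊢
    rw [hw]
    cases e with
    | true => exact act_of_sends h.1
    | false => exact Equiv.Perm.inv_eq_iff_eq.2 (act_of_sends h.1).symm
  | case3 => simp at h

/-- The commutator of two words. -/
def commWord (u v : List (ℕ × Bool)) : List (ℕ × Bool) :=
  FreeGroup.invRev u ++ FreeGroup.invRev v ++ u ++ v

theorem mk_commWord (u v : List (ℕ × Bool)) :
    FreeGroup.mk (commWord u v) = commE (FreeGroup.mk u) (FreeGroup.mk v) := rfl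

theorem map_commE {G H : Type*} [Group G] [Group H] (f : G →* H) (u v : G) :
    f (commE u v) = commE (f u) (f v) := by
  simp [commE]

/-- The word in the letters `yₖ = xₖ⋯x₄` representing
`[[[x₁, x₂], [x₁, x₂x₃]], [[x₁, x₂], [x₁, x₂x₃x₄]]]`. -/
def generatorWord : List (ℕ × Bool) :=
  let x₁ := [(1, true), (2, false)]
  let x₂ := [(2, true), (3, false)]
  commWord (commWord (commWord x₁ x₂) (commWord x₁ [(2, true), (4, false)]))
    (commWord (commWord x₁ x₂) (commWord x₁ [(2, true)]))

/-- The numbers of the states visited while `generatorWord` acts on the zero state, from the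
last one to the first one. -/
def generatorPath : List ℕ :=
  [2097152, 2097160, 2097162, 2097160, 2097161, 2105515, 2960035, 2960034, 2960000, 2960068,
   862918, 2960068, 2960069, 862823, 601891, 601890, 601856, 601890, 601891, 271659, 271753,
   271752, 2368906, 271752, 271744, 271778, 271779, 139495, 131141, 131140, 131142, 131140,
   131072, 131074, 131072, 131073, 139427, 139426, 139392, 139460, 139462, 139460, 139461, 139367,
   140579, 140578, 140544, 140578, 140579, 140673, 140672, 140674, 140672, 140706, 140707, 270567,
   262213, 262212, 262214, 262212, 262144, 262212, 262214, 262212, 262213, 270567, 140707, 140706,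
   140672, 140680, 2237834, 140680, 140681, 140587, 3092259, 3092258, 3092224, 3092258, 3092259,
   731751, 2828997, 2828996, 731846, 2828996, 2828928, 2828962, 2828963, 401579, 393225, 393224,
   393226, 393224, 393216, 393284, 393286, 393284, 393285, 401639, 9635, 9634, 9600, 9602, 9600,
   9601, 9507, 9506, 9472, 9506, 9507, 8295, 8389, 8388, 8390, 8388, 8320, 8354, 8355, 1, 0, 2, 0]

theorem isPath_generatorPath : isPath generatorWord generatorPath = true := by
  decide +kernel

theorem ofBits_zero : ofBits 0 = 0 := by
  funext j
  exact Nat.zero_testBit j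

theorem freeAct_generatorWord : freeAct (FreeGroup.mk generatorWord) 0 = ofBits 2097152 := by
  have h := freeAct_of_isPath isPath_generatorPath (by decide +kernel)
  have hlast : generatorPath.getLast (by decide +kernel) = 0 := by decide +kernel
  rw [hlast, ofBits_zero] at h
  exact h

end Word

end SymmComm

/-- In the free group on four generators `x₁, x₂, x₃, x₄` (with `x_{i+1} = FreeGroup.of i`),
the element `w = [[[x₁, x₂], [x₁, x₂x₃]], [[x₁, x₂], [x₁, x₂x₃x₄]]]` does NOT belong to
the symmetric commutator subgroup `[R₀, R₁, R₂, R₃, R₄]_S`, where `R_i` is the normal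
closure of `x_i` and `R₀` is the normal closure of `x₁x₂x₃x₄`. -/
theorem generator_not_mem_symmComm :
    commE
        (commE (commE (FreeGroup.of 0) (FreeGroup.of 1))
          (commE (FreeGroup.of 0) (FreeGroup.of 1 * FreeGroup.of (2 : Fin 4))))
        (commE (commE (FreeGroup.of 0) (FreeGroup.of 1))
          (commE (FreeGroup.of 0)
            (FreeGroup.of 1 * FreeGroup.of 2 * FreeGroup.of (3 : Fin 4)))) ∉
      symmComm (R 4) := by
  intro hw
  have h := SymmComm.coord_baseAct_of_mem hw
  have e : ∀ k : Fin 4, SymmComm.baseAct (FreeGroup.of k) = SymmComm.freeAct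
      (FreeGroup.mk [((k : ℕ) + 1, true), (k + 2, false)]) := fun k => by
    simp [SymmComm.baseAct, SymmComm.freeAct]
  have e₂ : SymmComm.baseAct (FreeGroup.of 1 * FreeGroup.of 2) = SymmComm.freeAct
      (FreeGroup.mk [(2, true), (4, false)]) := by
    simp [SymmComm.baseAct, SymmComm.freeAct]
  have e₃ : SymmComm.baseAct (FreeGroup.of 1 * FreeGroup.of 2 * FreeGroup.of 3) =
      SymmComm.freeAct (FreeGroup.mk [(2, true)]) := by
    simp [SymmComm.baseAct, SymmComm.freeAct, SymmComm.act_of_le]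
  simp only [SymmComm.map_commE, e₂, e₃, e] at h
  simp only [← SymmComm.map_commE, ← SymmComm.mk_commWord] at h
  have hg := SymmComm.freeAct_generatorWord
  simp only [SymmComm.generatorWord] at hg
  norm_num at h
  rw [hg] at h
  revert h
  decide
end
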